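/- Let C_X ∈ ℝ^{q×q} and C_E ∈ ℝ^{n×n} be symmetric positive definite, B ∈ ℝ^{n×q}, C_Y = B C_X Bᵀ + C_E, and fix 1 ≤ r ≤ n. For each full-column-rank V ∈ ℝ^{n×r}, let C_V = C_X − C_X Bᵀ V (Vᵀ C_Y V)⁻¹ Vᵀ B C_X, G_V Vᵀ = C_X Bᵀ V (Vᵀ C_Y V)⁻¹ Vᵀ, h_V = C_V C_X⁻¹ m_X + G_V Vᵀ B m_X, and let C*, G*, h* be the corresponding full-model quantities (V = I_n). Define J₁(V) = ½( trace(C* C_V⁻¹) − log det(C* C_V⁻¹) − q + trace( C_V⁻¹ (G* − G_V Vᵀ) C_Y (G* − G_V Vᵀ)ᵀ ) + (h* − h_V)ᵀ C_V⁻¹ (h* − h_V) ). Then there exists a full-column-rank V₀ ∈ ℝ^{n×r} such that J₁(V₀) ≤ J₁(V) for every full-column-rank V ∈ ℝ^{n×r}. -/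

import Mathlib

open Matrix

/-- Reduced posterior covariance `C_V = C_X − C_X Bᵀ V (Vᵀ C_Y V)⁻¹ Vᵀ B C_X`. -/
noncomputable def redCov {q n r : ℕ} (CX : Matrix (Fin q) (Fin q) ℝ)
    (CY : Matrix (Fin n) (Fin n) ℝ) (B : Matrix (Fin n) (Fin q) ℝ)
    (V : Matrix (Fin n) (Fin r) ℝ) : Matrix (Fin q) (Fin q) ℝ :=
  CX - CX * Bᵀ * V * (Vᵀ * CY * V)⁻¹ * Vᵀ * B * CX

/-- Reduced gain matrix `G_V Vᵀ = C_X Bᵀ V (Vᵀ C_Y V)⁻¹ Vᵀ`. -/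
noncomputable def redGain {q n r : ℕ} (CX : Matrix (Fin q) (Fin q) ℝ)
    (CY : Matrix (Fin n) (Fin n) ℝ) (B : Matrix (Fin n) (Fin q) ℝ)
    (V : Matrix (Fin n) (Fin r) ℝ) : Matrix (Fin q) (Fin n) ℝ :=
  CX * Bᵀ * V * (Vᵀ * CY * V)⁻¹ * Vᵀ

/-- Constant part of the reduced posterior mean `h_V = C_V C_X⁻¹ m_X + G_V Vᵀ B m_X`. -/
noncomputable def redShift {q n r : ℕ} (CX : Matrix (Fin q) (Fin q) ℝ)
    (CY : Matrix (Fin n) (Fin n) ℝ) (B : Matrix (Fin n) (Fin q) ℝ)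
    (mX : Fin q → ℝ) (V : Matrix (Fin n) (Fin r) ℝ) : Fin q → ℝ :=
  redCov CX CY B V *ᵥ (CX⁻¹ *ᵥ mX) + redGain CX CY B V *ᵥ (B *ᵥ mX)

/-- The expected Kullback-Leibler divergence `J₁(V)` between the posterior
distributions of the full model (`V = I_n`) and the reduced model, in closed
form (Proposition 3.4). -/
noncomputable def J₁ {q n r : ℕ} (CX : Matrix (Fin q) (Fin q) ℝ)
    (CY : Matrix (Fin n) (Fin n) ℝ) (B : Matrix (Fin n) (Fin q) ℝ)
    (mX : Fin q → ℝ) (V : Matrix (Fin n) (Fin r) ℝ) : ℝ :=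
  (1 / 2) * (Matrix.trace (redCov CX CY B (1 : Matrix (Fin n) (Fin n) ℝ) *
      (redCov CX CY B V)⁻¹) -
    Real.log (redCov CX CY B (1 : Matrix (Fin n) (Fin n) ℝ) *
      (redCov CX CY B V)⁻¹).det - q +
    Matrix.trace ((redCov CX CY B V)⁻¹ *
      (redGain CX CY B (1 : Matrix (Fin n) (Fin n) ℝ) - redGain CX CY B V) * CY *
      (redGain CX CY B (1 : Matrix (Fin n) (Fin n) ℝ) - redGain CX CY B V)ᵀ) +
    (redShift CX CY B mX (1 : Matrix (Fin n) (Fin n) ℝ) - redShift CX CY B mX V) ⬝ᵥ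
      ((redCov CX CY B V)⁻¹ *ᵥ
        (redShift CX CY B mX (1 : Matrix (Fin n) (Fin n) ℝ) - redShift CX CY B mX V)))

theorem mulVec_injective_of_rank_eq {n r : ℕ} {V : Matrix (Fin n) (Fin r) ℝ} (hV : V.rank = r) :
    Function.Injective V.mulVec := by
  have h : LinearMap.ker V.mulVecLin = ⊥ := by
    have h₁ := V.mulVecLin.finrank_range_add_finrank_ker
    rw [Module.finrank_fin_fun] at h₁
    change V.rank + _ = r at h₁
    exact Submodule.finrank_eq_zero.mp (by omega)
  exact LinearMap.ker_eq_bot.mp h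

theorem rank_eq_of_transpose_mul_self_eq_one {n r : ℕ} {V : Matrix (Fin n) (Fin r) ℝ}
    (hV : Vᵀ * V = 1) : V.rank = r := by
  rw [← rank_transpose_mul_self, hV, rank_one, Fintype.card_fin]

theorem posDef_transpose_mul_mul {n r : ℕ} {A : Matrix (Fin n) (Fin n) ℝ} (hA : A.PosDef)
    {V : Matrix (Fin n) (Fin r) ℝ} (hV : V.rank = r) : (Vᵀ * A * V).PosDef := by
  simpa using hA.conjTranspose_mul_mul_same (mulVec_injective_of_rank_eq hV)

/-- Every matrix of full column rank factors as an orthonormal frame times an invertible matrix. -/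
theorem exists_orthonormal_mul {n r : ℕ} {V : Matrix (Fin n) (Fin r) ℝ} (hV : V.rank = r) :
    ∃ (U : Matrix (Fin n) (Fin r) ℝ) (S : Matrix (Fin r) (Fin r) ℝ),
      Uᵀ * U = 1 ∧ IsUnit S.det ∧ V = U * S := by
  have hpd : (Vᵀ * V).PosDef := by simpa using posDef_transpose_mul_mul PosDef.one hV
  obtain ⟨S, hS⟩ : ∃ S : Matrix (Fin r) (Fin r) ℝ, Vᵀ * V = Sᵀ * S := by
    open scoped MatrixOrder Matrix.Norms.L2Operator in
    obtain ⟨S, hS⟩ := CStarAlgebra.nonneg_iff_eq_star_mul_self.mp hpd.posSemidef.nonneg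
    exact ⟨S, by simpa [star_eq_conjTranspose] using hS⟩
  have hdet : IsUnit S.det := by
    have h := hpd.det_pos.ne'
    rw [hS, det_mul] at h
    exact (right_ne_zero_of_mul h).isUnit
  refine ⟨V * S⁻¹, S, ?_, hdet, ?_⟩
  · calc (V * S⁻¹)ᵀ * (V * S⁻¹) = S⁻¹ᵀ * (Vᵀ * V) * S⁻¹ := by
          simp only [transpose_mul, Matrix.mul_assoc]
      _ = (S * S⁻¹)ᵀ * (S * S⁻¹) := by
          rw [hS]; simp only [transpose_mul, Matrix.mul_assoc]
      _ = 1 := by simp [mul_nonsing_inv _ hdet]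
  · rw [Matrix.mul_assoc, nonsing_inv_mul _ hdet, Matrix.mul_one]

theorem mul_inv_mul_transpose_of_isUnit {n r : ℕ} (A : Matrix (Fin n) (Fin n) ℝ)
    (U : Matrix (Fin n) (Fin r) ℝ) {S : Matrix (Fin r) (Fin r) ℝ} (hS : IsUnit S.det) :
    U * S * ((U * S)ᵀ * A * (U * S))⁻¹ * (U * S)ᵀ = U * (Uᵀ * A * U)⁻¹ * Uᵀ := by
  have hT : IsUnit Sᵀ.det := by rwa [det_transpose]
  have h : (U * S)ᵀ * A * (U * S) = Sᵀ * (Uᵀ * A * U) * S := by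
    simp only [transpose_mul, Matrix.mul_assoc]
  rw [h, Matrix.mul_inv_rev, Matrix.mul_inv_rev, transpose_mul]
  calc U * S * (S⁻¹ * ((Uᵀ * A * U)⁻¹ * Sᵀ⁻¹)) * (Sᵀ * Uᵀ)
      = U * (S * S⁻¹) * (Uᵀ * A * U)⁻¹ * (Sᵀ⁻¹ * Sᵀ) * Uᵀ := by simp only [Matrix.mul_assoc]
    _ = U * (Uᵀ * A * U)⁻¹ * Uᵀ := by
      rw [mul_nonsing_inv _ hS, nonsing_inv_mul _ hT, Matrix.mul_one, Matrix.mul_one]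

section

variable {q n r : ℕ} (CX : Matrix (Fin q) (Fin q) ℝ) (CY : Matrix (Fin n) (Fin n) ℝ)
  (B : Matrix (Fin n) (Fin q) ℝ)

theorem redCov_eq_sub_redGain (V : Matrix (Fin n) (Fin r) ℝ) :
    redCov CX CY B V = CX - redGain CX CY B V * B * CX := rfl

theorem redGain_mul_of_isUnit (U : Matrix (Fin n) (Fin r) ℝ) {S : Matrix (Fin r) (Fin r) ℝ}
    (hS : IsUnit S.det) : redGain CX CY B (U * S) = redGain CX CY B U := by
  have h := congrArg (CX * Bᵀ * ·) (mul_inv_mul_transpose_of_isUnit CY U hS)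
  simpa only [redGain, Matrix.mul_assoc] using h

theorem J₁_mul_of_isUnit (mX : Fin q → ℝ) (U : Matrix (Fin n) (Fin r) ℝ)
    {S : Matrix (Fin r) (Fin r) ℝ} (hS : IsUnit S.det) :
    J₁ CX CY B mX (U * S) = J₁ CX CY B mX U := by
  simp only [J₁, redShift, redCov_eq_sub_redGain, redGain_mul_of_isUnit CX CY B U hS]

end

theorem det_redCov_ne_zero {q n r : ℕ} {CX : Matrix (Fin q) (Fin q) ℝ}
    {CE : Matrix (Fin n) (Fin n) ℝ} (hCX : CX.PosDef) (hCE : CE.PosDef)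
    (B : Matrix (Fin n) (Fin q) ℝ) {V : Matrix (Fin n) (Fin r) ℝ} (hV : V.rank = r)
    (hW : (Vᵀ * (B * CX * Bᵀ + CE) * V).det ≠ 0) :
    (redCov CX (B * CX * Bᵀ + CE) B V).det ≠ 0 := by
  let _ : Invertible CX := hCX.isUnit.invertible
  let _ : Invertible (Vᵀ * (B * CX * Bᵀ + CE) * V) :=
    invertibleOfIsUnitDet _ hW.isUnit
  have h₁ := det_fromBlocks₁₁ (Vᵀ * (B * CX * Bᵀ + CE) * V) (Vᵀ * B * CX) (CX * Bᵀ * V) CX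
  have h₂ := det_fromBlocks₂₂ (Vᵀ * (B * CX * Bᵀ + CE) * V) (Vᵀ * B * CX) (CX * Bᵀ * V) CX
  have h₃ : Vᵀ * (B * CX * Bᵀ + CE) * V - Vᵀ * B * CX * ⅟CX * (CX * Bᵀ * V) = Vᵀ * CE * V := by
    rw [invOf_eq_nonsing_inv, Matrix.mul_assoc (Vᵀ * B), mul_nonsing_inv _ hCX.det_pos.ne'.isUnit]
    simp only [Matrix.mul_one, Matrix.mul_add, Matrix.add_mul, Matrix.mul_assoc, add_sub_cancel_left]
  have h₄ : CX - CX * Bᵀ * V * ⅟(Vᵀ * (B * CX * Bᵀ + CE) * V) * (Vᵀ * B * CX) =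
      redCov CX (B * CX * Bᵀ + CE) B V := by
    simp only [redCov, invOf_eq_nonsing_inv, Matrix.mul_assoc]
  rw [h₃] at h₂
  rw [h₄, h₂] at h₁
  exact right_ne_zero_of_mul
    (h₁ ▸ mul_ne_zero hCX.det_pos.ne' (posDef_transpose_mul_mul hCE hV).det_pos.ne')

theorem Continuous.matrix_nonsing_inv {X : Type*} [TopologicalSpace X] {m : ℕ}
    {f : X → Matrix (Fin m) (Fin m) ℝ} (hf : Continuous f) (h : ∀ x, (f x).det ≠ 0) :
    Continuous fun x => (f x)⁻¹ := by
  refine continuous_iff_continuousAt.mpr fun x => ?_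
  exact ContinuousAt.comp (g := fun A : Matrix (Fin m) (Fin m) ℝ => A⁻¹)
    (continuousAt_matrix_inv (f x) (by simpa using continuousAt_inv₀ (h x))) hf.continuousAt

theorem isCompact_orthonormal_frames (n r : ℕ) :
    IsCompact {V : Matrix (Fin n) (Fin r) ℝ | Vᵀ * V = 1} := by
  have hbox : IsCompact (Set.univ.pi fun _ : Fin n => Set.univ.pi fun _ : Fin r =>
      Set.Icc (-1 : ℝ) 1) :=
    isCompact_univ_pi fun _ => isCompact_univ_pi fun _ => isCompact_Icc
  refine hbox.of_isClosed_subset (isClosed_eq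
    (continuous_id.matrix_transpose.matrix_mul continuous_id) continuous_const) ?_
  intro (V : Matrix (Fin n) (Fin r) ℝ) hV i _ j _
  have h := congrFun (congrFun (show Vᵀ * V = 1 from hV) j) j
  rw [mul_apply, one_apply_eq] at h
  have hle : V i j * V i j ≤ 1 := by
    rw [← h]
    exact Finset.single_le_sum (f := fun k => Vᵀ j k * V k j)
      (fun k _ => mul_self_nonneg (V k j)) (Finset.mem_univ i)
  exact ⟨by nlinarith, by nlinarith⟩

theorem exists_orthonormal_frame {n r : ℕ} (hrn : r ≤ n) :
    ∃ V : Matrix (Fin n) (Fin r) ℝ, Vᵀ * V = 1 := by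
  refine ⟨(1 : Matrix (Fin n) (Fin n) ℝ).submatrix id (Fin.castLE hrn), ?_⟩
  rw [transpose_submatrix, ← submatrix_mul _ _ _ _ _ Function.bijective_id]
  simp [submatrix_one _ (Fin.castLE_injective hrn)]

theorem Continuous.J₁ {X : Type*} [TopologicalSpace X] {q n r : ℕ}
    {CX : Matrix (Fin q) (Fin q) ℝ} {CE : Matrix (Fin n) (Fin n) ℝ}
    (hCX : CX.PosDef) (hCE : CE.PosDef) (B : Matrix (Fin n) (Fin q) ℝ) (mX : Fin q → ℝ)
    {V : X → Matrix (Fin n) (Fin r) ℝ} (hV : Continuous V) (hr : ∀ x, (V x).rank = r) :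
    Continuous fun x => _root_.J₁ CX (B * CX * Bᵀ + CE) B mX (V x) := by
  have hCY : (B * CX * Bᵀ + CE).PosDef := by
    refine PosDef.posSemidef_add ?_ hCE
    simpa using hCX.posSemidef.mul_mul_conjTranspose_same B
  have hdet {k : ℕ} {W : Matrix (Fin n) (Fin k) ℝ} (hW : W.rank = k) :
      (redCov CX (B * CX * Bᵀ + CE) B W).det ≠ 0 :=
    det_redCov_ne_zero hCX hCE B hW (posDef_transpose_mul_mul hCY hW).det_pos.ne'
  have hfull : (redCov CX (B * CX * Bᵀ + CE) B (1 : Matrix (Fin n) (Fin n) ℝ)).det ≠ 0 :=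
    hdet (by simp)
  generalize B * CX * Bᵀ + CE = CY at hCY hdet hfull ⊢
  have hG : Continuous fun x => redGain CX CY B (V x) :=
    ((continuous_const.matrix_mul hV).matrix_mul
      (((hV.matrix_transpose.matrix_mul continuous_const).matrix_mul hV).matrix_nonsing_inv
        fun x => (posDef_transpose_mul_mul hCY (hr x)).det_pos.ne')).matrix_mul
      hV.matrix_transpose
  have hC : Continuous fun x => redCov CX CY B (V x) :=
    continuous_const.sub
      ((hG.matrix_mul continuous_const).matrix_mul continuous_const)
  have hCinv := hC.matrix_nonsing_inv fun x => hdet (hr x)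
  have hh : Continuous fun x => redShift CX CY B mX (V x) :=
    (hC.matrix_mulVec continuous_const).add (hG.matrix_mulVec continuous_const)
  have hCC := (continuous_const (y := redCov CX CY B (1 : Matrix (Fin n) (Fin n) ℝ))).matrix_mul
    hCinv
  have hlog := hCC.matrix_det.log fun x => by
    rw [det_mul, det_nonsing_inv, Ring.inverse_eq_inv']
    exact mul_ne_zero hfull (inv_ne_zero (hdet (hr x)))
  have hGd := (continuous_const (y := redGain CX CY B (1 : Matrix (Fin n) (Fin n) ℝ))).sub hG
  have hhd := (continuous_const
    (y := redShift CX CY B mX (1 : Matrix (Fin n) (Fin n) ℝ))).sub hh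
  exact continuous_const.mul ((((hCC.matrix_trace.sub hlog).sub continuous_const).add
    (((hCinv.matrix_mul hGd).matrix_mul continuous_const).matrix_mul
      hGd.matrix_transpose).matrix_trace).add
    (hhd.dotProduct (hCinv.matrix_mulVec hhd)))

/-- Theorem 3.5: the expected Kullback-Leibler divergence `J₁` attains its
minimum over the set of full-column-rank matrices `V ∈ ℝ^{n×r}`. -/
theorem stmt_11 {q n r : ℕ} (hr : 1 ≤ r) (hrn : r ≤ n)
    (CX : Matrix (Fin q) (Fin q) ℝ) (CE : Matrix (Fin n) (Fin n) ℝ)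
    (hCX : CX.PosDef) (hCE : CE.PosDef)
    (B : Matrix (Fin n) (Fin q) ℝ)
    (CY : Matrix (Fin n) (Fin n) ℝ) (hCY : CY = B * CX * Bᵀ + CE)
    (mX : Fin q → ℝ) :
    ∃ V₀ : Matrix (Fin n) (Fin r) ℝ, V₀.rank = r ∧
      ∀ V : Matrix (Fin n) (Fin r) ℝ, V.rank = r →
        J₁ CX CY B mX V₀ ≤ J₁ CX CY B mX V := by
  subst hCY
  obtain ⟨V₀, hV₀, hmin⟩ := (isCompact_orthonormal_frames n r).exists_isMinOn
    (exists_orthonormal_frame hrn)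
    (f := J₁ CX (B * CX * Bᵀ + CE) B mX)
    (continuousOn_iff_continuous_domRestrict.mpr (Continuous.J₁ hCX hCE B mX
      continuous_subtype_val fun V => rank_eq_of_transpose_mul_self_eq_one V.2))
  refine ⟨V₀, rank_eq_of_transpose_mul_self_eq_one hV₀, fun V hV => ?_⟩
  obtain ⟨U, S, hU, hS, rfl⟩ := exists_orthonormal_mul hV
  rw [J₁_mul_of_isUnit CX _ B mX U hS]
  exact hmin hU
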